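/- For every m≥7, D(t_m) − D((t_m+t_{m-2}−3)/2) = (m/44)(−7t_m+2t_{m-1}+21t_{m-2}) + (1/11)(−10t_m+21t_{m-1}−6t_{m-2}) − m/12 + (1/3)·[m≡1 (mod 3)] + (2/3)·[m≡2 (mod 3)], where [P] equals 1 if P holds and 0 otherwise. -/

import Mathlib

/-- The three-letter alphabet of the Tribonacci word. -/
inductive TLetter : Type
  | a | b | c
deriving DecidableEq

/-- The Tribonacci substitution σ(a)=ab, σ(b)=ac, σ(c)=a. -/
def tsubst : TLetter → List TLetter
  | .a => [.a, .b]
  | .b => [.a, .c]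
  | .c => [.a]

/-- `Tword m = σ^m(a)`, the m-th finite Tribonacci word. -/
def Tword : ℕ → List TLetter
  | 0 => [.a]
  | n + 1 => (Tword n).flatMap tsubst

/-- The prefix 𝕋[1,n] of the Tribonacci word of length n
(each `Tword n` is a prefix of the next and has length ≥ n). -/
def TPrefix (n : ℕ) : List TLetter := (Tword n).take n

/-- A word is a factor of the Tribonacci word 𝕋. -/
def IsFactorT (w : List TLetter) : Prop := ∃ m, w <:+: Tword m

/-- `tribAux i = t_{i-2}`: Tribonacci numbers, shifted so that the index is a natural. -/
def tribAux : ℕ → ℕ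
  | 0 => 0
  | 1 => 1
  | 2 => 1
  | n + 3 => tribAux (n + 2) + tribAux (n + 1) + tribAux n

/-- The Tribonacci numbers `t m` for `m : ℤ`: t₋₂=0, t₋₁=1, t₀=1,
`t m = t (m-1) + t (m-2) + t (m-3)` for m ≥ 1. (Junk value 0 below -2.) -/
def t (m : ℤ) : ℕ := tribAux (m + 2).toNat

/-- Kernel numbers: k₀=0, k₁=k₂=1, `k m = k (m-1) + k (m-2) + k (m-3) - 1` for m ≥ 3. -/
def kAux : ℕ → ℕ
  | 0 => 0
  | 1 => 1
  | 2 => 1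
  | n + 3 => kAux (n + 2) + kAux (n + 1) + kAux n - 1

def kker (m : ℤ) : ℕ := kAux m.toNat

/-- `A n`: the number of distinct nonempty words w with ww a factor of 𝕋[1,n]. -/
noncomputable def A (n : ℕ) : ℕ := Nat.card {w : List TLetter // w ≠ [] ∧ (w ++ w) <:+: TPrefix n}

/-- `B n`: the number of occurrences of squares in 𝕋[1,n], i.e. of pairs (w,i) with
w nonempty, i ≥ 1, ww occurring in 𝕋 at position i and i + 2|w| - 1 ≤ n. -/
noncomputable def B (n : ℕ) : ℕ :=
  Nat.card {p : List TLetter × ℕ // p.1 ≠ [] ∧ 1 ≤ p.2 ∧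
    p.2 + 2 * p.1.length - 1 ≤ n ∧ (p.1 ++ p.1) <+: (TPrefix n).drop (p.2 - 1)}

/-- `C n`: the number of distinct nonempty words w with www a factor of 𝕋[1,n]. -/
noncomputable def C (n : ℕ) : ℕ := Nat.card {w : List TLetter // w ≠ [] ∧ (w ++ w ++ w) <:+: TPrefix n}

/-- `D n`: the number of occurrences of cubes in 𝕋[1,n], i.e. of pairs (w,i) with
w nonempty, i ≥ 1, www occurring in 𝕋 at position i and i + 3|w| - 1 ≤ n. -/
noncomputable def D (n : ℕ) : ℕ :=
  Nat.card {p : List TLetter × ℕ // p.1 ≠ [] ∧ 1 ≤ p.2 ∧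
    p.2 + 3 * p.1.length - 1 ≤ n ∧ (p.1 ++ p.1 ++ p.1) <+: (TPrefix n).drop (p.2 - 1)}


namespace TribonacciCubes

open TLetter

/-! ### The infinite Tribonacci word -/

/-- The cyclic successor of a letter, which is also the last letter of its image. -/
def next : TLetter → TLetter
  | a => b
  | b => c
  | c => a

theorem next_injective : Function.Injective next := by
  intro x y h
  cases x <;> cases y <;> simp_all [next]

theorem Tword_prefix_succ (n : ℕ) : Tword n <+: Tword (n + 1) := by
  induction n with
  | zero => exact ⟨[b], rfl⟩
  | succ n ih =>
    obtain ⟨s, hs⟩ := ih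
    refine ⟨s.flatMap tsubst, ?_⟩
    change (Tword n).flatMap tsubst ++ _ = (Tword (n + 1)).flatMap tsubst
    rw [← hs, List.flatMap_append]

theorem Tword_prefix {m n : ℕ} (h : m ≤ n) : Tword m <+: Tword n := by
  induction n, h using Nat.le_induction with
  | base => exact List.prefix_rfl
  | succ n _ ih => exact ih.trans (Tword_prefix_succ n)

theorem length_le_length_flatMap (w : List TLetter) : w.length ≤ (w.flatMap tsubst).length := by
  induction w with
  | nil => simp
  | cons x w ih =>
    have h : 1 ≤ (tsubst x).length := by cases x <;> simp [tsubst]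
    rw [List.flatMap_cons, List.length_append, List.length_cons]
    omega

theorem lt_length_Tword (n : ℕ) : n < (Tword n).length := by
  have key : ∀ n, ∃ w, Tword n = a :: w ∧ n ≤ w.length := by
    intro n
    induction n with
    | zero => exact ⟨[], rfl, le_rfl⟩
    | succ n ih =>
      obtain ⟨w, hw, hn⟩ := ih
      refine ⟨b :: w.flatMap tsubst, ?_, ?_⟩
      · simp [Tword, hw, tsubst]
      · have := length_le_length_flatMap w
        simp only [List.length_cons]
        omega
  obtain ⟨w, hw, hn⟩ := key n
  rw [hw, List.length_cons]
  omega

/-- The infinite Tribonacci word, indexed from `0`. -/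
def T (i : ℕ) : TLetter := (Tword i)[i]'(lt_length_Tword i)

theorem getElem_Tword {n i : ℕ} (h : i < (Tword n).length) : (Tword n)[i] = T i := by
  unfold T
  rcases le_total n i with hn | hn
  · exact (Tword_prefix hn).getElem h
  · exact ((Tword_prefix hn).getElem (lt_length_Tword i)).symm

/-- The prefix of length `n` of the infinite Tribonacci word. -/
def pre (n : ℕ) : List TLetter := (List.range n).map T

@[simp] theorem length_pre (n : ℕ) : (pre n).length = n := by simp [pre]

theorem pre_succ (n : ℕ) : pre (n + 1) = pre n ++ [T n] := by
  simp [pre, List.range_succ]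

theorem eq_pre_of_prefix {w : List TLetter} {n : ℕ} (h : w <+: Tword n) : w = pre w.length := by
  apply List.ext_getElem (by simp)
  intro i h1 h2
  rw [h.getElem h1, getElem_Tword]
  simp [pre]

theorem TPrefix_eq_pre (n : ℕ) : TPrefix n = pre n := by
  have h := eq_pre_of_prefix (List.take_prefix n (Tword n))
  rwa [List.length_take, min_eq_left (lt_length_Tword n).le] at h

/-- The length of the image under the substitution of the prefix of length `j`. -/
def pos (j : ℕ) : ℕ := ((pre j).flatMap tsubst).length

theorem flatMap_pre (j : ℕ) : (pre j).flatMap tsubst = pre (pos j) := by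
  have h : pre j <+: Tword j := by
    rw [← TPrefix_eq_pre]
    exact List.take_prefix _ _
  obtain ⟨s, hs⟩ := h
  refine eq_pre_of_prefix (n := j + 1) ⟨s.flatMap tsubst, ?_⟩
  rw [← List.flatMap_append, hs]
  rfl

theorem pos_zero : pos 0 = 0 := rfl

theorem pos_succ (j : ℕ) : pos (j + 1) = pos j + (tsubst (T j)).length := by
  simp [pos, pre_succ]

theorem pre_pos_succ (j : ℕ) : pre (pos (j + 1)) = pre (pos j) ++ tsubst (T j) := by
  rw [← flatMap_pre, ← flatMap_pre, pre_succ, List.flatMap_append]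
  simp

theorem getElem_pre {n i : ℕ} (h : i < (pre n).length) : (pre n)[i] = T i := by
  simp [pre]

theorem T_pos_add {j x : ℕ} (h : x < (tsubst (T j)).length) :
    T (pos j + x) = (tsubst (T j))[x] := by
  have h1 : pos j + x < (pre (pos (j + 1))).length := by
    rw [length_pre, pos_succ]; omega
  rw [← getElem_pre h1]
  simp only [pre_pos_succ]
  rw [List.getElem_append_right (by simp)]
  simp

theorem T_pos (j : ℕ) : T (pos j) = a := by
  have h : 0 < (tsubst (T j)).length := by cases T j <;> simp [tsubst]
  have := T_pos_add h
  rw [add_zero] at this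
  rw [this]
  generalize T j = x at h ⊢
  cases x <;> rfl

theorem T_zero : T 0 = a := T_pos 0

theorem pos_succ_of_ne {j : ℕ} (h : T j ≠ c) : pos (j + 1) = pos j + 2 := by
  rw [pos_succ]
  cases hj : T j <;> simp_all [tsubst]

theorem pos_succ_of_eq {j : ℕ} (h : T j = c) : pos (j + 1) = pos j + 1 := by
  rw [pos_succ, h]; rfl

theorem T_pos_add_one (j : ℕ) : T (pos j + 1) = next (T j) := by
  by_cases hc : T j = c
  · rw [← pos_succ_of_eq hc, T_pos, hc]; rfl
  · have h : 1 < (tsubst (T j)).length := by cases hj : T j <;> simp_all [tsubst]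
    rw [T_pos_add h]
    generalize T j = x at h hc ⊢
    cases x <;> simp_all [next, tsubst]

theorem pos_lt_pos_succ (j : ℕ) : pos j < pos (j + 1) := by
  by_cases hc : T j = c
  · rw [pos_succ_of_eq hc]; omega
  · rw [pos_succ_of_ne hc]; omega

theorem pos_strictMono : StrictMono pos := strictMono_nat_of_lt_succ pos_lt_pos_succ

theorem exists_pos (i : ℕ) : ∃ j, i = pos j ∨ (T j ≠ c ∧ i = pos j + 1) := by
  induction i with
  | zero => exact ⟨0, Or.inl rfl⟩
  | succ i ih =>
    obtain ⟨j, h | ⟨hc, h⟩⟩ := ih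
    · by_cases hc : T j = c
      · exact ⟨j + 1, Or.inl (by rw [pos_succ_of_eq hc, h])⟩
      · exact ⟨j, Or.inr ⟨hc, by rw [h]⟩⟩
    · exact ⟨j + 1, Or.inl (by rw [pos_succ_of_ne hc, h])⟩

theorem exists_pos_of_eq_a {i : ℕ} (h : T i = a) : ∃ j, i = pos j := by
  obtain ⟨j, hj | ⟨hc, hj⟩⟩ := exists_pos i
  · exact ⟨j, hj⟩
  · rw [hj, T_pos_add_one] at h
    cases hx : T j <;> simp_all [next]

theorem exists_pos_of_ne_a {i : ℕ} (h : T i ≠ a) : ∃ j, T j ≠ c ∧ i = pos j + 1 := by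
  obtain ⟨j, hj | hj⟩ := exists_pos i
  · exact absurd (hj ▸ T_pos j) h
  · exact ⟨j, hj⟩

theorem T_succ_of_ne_a {i : ℕ} (h : T i ≠ a) : T (i + 1) = a := by
  obtain ⟨j, hc, rfl⟩ := exists_pos_of_ne_a h
  rw [← T_pos (j + 1), pos_succ_of_ne hc]

theorem T_add_two_of_eq_c {i : ℕ} (h : T i = c) : T (i + 2) = b := by
  obtain ⟨j, hc, rfl⟩ := exists_pos_of_ne_a (i := i) (by simp [h])
  have hb : T j = b := by
    rw [T_pos_add_one] at h
    exact next_injective h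
  have h1 := T_succ_of_ne_a (i := j) (by simp [hb])
  have h2 := T_pos_add_one (j + 1)
  rw [pos_succ_of_ne hc, h1] at h2
  exact h2

/-! ### Iterated images of letters and prefixes -/

/-- The length of the `l`-th iterated image of a letter. -/
def len : ℕ → TLetter → ℕ
  | 0, _ => 1
  | l + 1, a => len l a + len l b
  | l + 1, b => len l a + len l c
  | l + 1, c => len l a

/-- The length of the word `σ^(l-1)(a) ⋯ σ(a) a`. -/
def bisp : ℕ → ℕ
  | 0 => 0
  | l + 1 => bisp l + len l a

theorem iterate_pos_succ (l j : ℕ) : pos^[l] (j + 1) = pos^[l] j + len l (T j) := by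
  induction l generalizing j with
  | zero => rfl
  | succ l ih =>
    rw [Function.iterate_succ_apply, Function.iterate_succ_apply]
    by_cases hc : T j = c
    · rw [pos_succ_of_eq hc, ih, T_pos, hc]; rfl
    · rw [pos_succ_of_ne hc, ih, ih, T_pos, T_pos_add_one]
      cases hx : T j
      · simp [next, len, add_assoc]
      · simp [next, len, add_assoc]
      · exact absurd hx hc

theorem iterate_pos_zero (l : ℕ) : pos^[l] 0 = 0 := Function.iterate_fixed pos_zero l

theorem iterate_pos_one (l : ℕ) : pos^[l] 1 = len l a := by
  have h := iterate_pos_succ l 0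
  rwa [iterate_pos_zero, T_zero, zero_add, zero_add] at h

theorem iterate_pos_strictMono (l : ℕ) : StrictMono (pos^[l]) := pos_strictMono.iterate l

theorem iterate_pos_len (l k : ℕ) : pos^[l] (len k a) = len (l + k) a := by
  rw [← iterate_pos_one, ← iterate_pos_one, Function.iterate_add_apply]

theorem len_eq_tribAux (l : ℕ) :
    len l a = tribAux (l + 2) ∧ len (l + 1) a = tribAux (l + 3) ∧
      len (l + 2) a = tribAux (l + 4) := by
  induction l with
  | zero => decide
  | succ l ih =>
    obtain ⟨h0, h1, h2⟩ := ih
    refine ⟨h1, h2, ?_⟩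
    have : tribAux (l + 5) = tribAux (l + 4) + tribAux (l + 3) + tribAux (l + 2) := rfl
    rw [this, ← h0, ← h1, ← h2]
    simp only [len]
    omega

theorem len_add_three (l : ℕ) : len (l + 3) a = len (l + 2) a + len (l + 1) a + len l a := by
  simp only [len]
  omega

/-- The prefix of length `n` occurs at position `y`. -/
def PrefixAt (n y : ℕ) : Prop := ∀ x < n, T (y + x) = T x

theorem PrefixAt.pos_add {n y : ℕ} (h : PrefixAt n y) : pos (y + n) = pos y + pos n := by
  induction n with
  | zero => rfl
  | succ n ih =>
    rw [← add_assoc, pos_succ, pos_succ, h n (by omega), ih fun x hx => h x (by omega), add_assoc]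

theorem PrefixAt.pos {n y : ℕ} (h : PrefixAt n y) : PrefixAt (pos n + 1) (pos y) := by
  have key : ∀ j ≤ n, TribonacciCubes.pos (y + j) =
      TribonacciCubes.pos y + TribonacciCubes.pos j := fun j hj =>
    PrefixAt.pos_add fun x hx => h x (by omega)
  intro x hx
  obtain ⟨j, rfl | ⟨hc, rfl⟩⟩ := exists_pos x
  · have hj : j ≤ n := pos_strictMono.le_iff_le.1 (by omega)
    rw [← key j hj, T_pos, T_pos]
  · have hj : j < n := pos_strictMono.lt_iff_lt.1 (by omega)
    rw [← add_assoc, ← key j hj.le, T_pos_add_one, T_pos_add_one, h j hj]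

theorem bisp_succ_aux (l : ℕ) :
    pos (bisp l) + 1 = bisp (l + 1) ∧ ∀ y, PrefixAt (bisp l) (pos^[l] y) := by
  induction l with
  | zero => exact ⟨rfl, fun y x hx => absurd hx (by simp [bisp])⟩
  | succ l ih =>
    obtain ⟨h1, h2⟩ := ih
    have h3 : ∀ y, PrefixAt (bisp (l + 1)) (pos^[l + 1] y) := fun y => by
      rw [← h1, Function.iterate_succ_apply']
      exact (h2 y).pos
    refine ⟨?_, h3⟩
    have h4 := (h2 1).pos_add
    rw [← Function.iterate_succ_apply' pos, iterate_pos_one, iterate_pos_one] at h4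
    change pos (bisp l + len l a) + 1 = bisp (l + 1) + len (l + 1) a
    rw [add_comm, add_comm (bisp l), h4, ← h1, Nat.succ_eq_add_one]
    omega

theorem pos_bisp (l : ℕ) : pos (bisp l) + 1 = bisp (l + 1) := (bisp_succ_aux l).1

theorem prefixAt_bisp (l y : ℕ) : PrefixAt (bisp l) (pos^[l] y) := (bisp_succ_aux l).2 y

theorem iterate_pos_bisp (l k : ℕ) : pos^[l] (bisp k) + bisp l = bisp (k + l) := by
  induction l with
  | zero => rfl
  | succ l ih =>
    rw [← add_assoc, ← pos_bisp (k + l), ← ih, (prefixAt_bisp l _).pos_add,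
      Function.iterate_succ_apply', ← pos_bisp l]
    omega

theorem bisp_lt (l : ℕ) :
    bisp l < 2 * len l a ∧ bisp l < 2 * len l b ∧ bisp l < len l a + 2 * len l c := by
  induction l with
  | zero => decide
  | succ l ih => simp only [bisp, len]; omega

theorem two_mul_bisp (l : ℕ) : 2 * bisp (l + 1) + 3 = len (l + 2) a + len l a := by
  induction l with
  | zero => decide
  | succ l ih =>
    have h : bisp (l + 2) = bisp (l + 1) + len (l + 1) a := rfl
    have h' := len_add_three l
    change 2 * bisp (l + 2) + 3 = len (l + 3) a + len (l + 1) a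
    omega

theorem len_pos (l : ℕ) (x : TLetter) : 0 < len l x := by
  induction l generalizing x with
  | zero => simp [len]
  | succ l ih =>
    have := ih a
    cases x <;> simp only [len] <;> omega

theorem len_c_le_bisp {l : ℕ} : 2 * len l c ≤ bisp l ↔ 4 ≤ l := by
  constructor
  · intro h
    by_contra! hl
    interval_cases l <;> revert h <;> decide
  · intro h
    obtain ⟨n, rfl⟩ := Nat.exists_eq_add_of_le' h
    have h1 : 2 * bisp (n + 4) + 3 = len (n + 5) a + len (n + 3) a := two_mul_bisp (n + 3)
    have h2 := len_pos n b
    have h3 := len_pos n c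
    have h4 := len_pos n a
    simp only [len] at h1 ⊢
    omega

theorem len_a_lt_two_mul {l : ℕ} (hl : 3 ≤ l) : len l a < 2 * len l c := by
  obtain ⟨n, rfl⟩ := Nat.exists_eq_add_of_le' hl
  have h2 := len_pos n b
  have h3 := len_pos n c
  have h4 := len_pos n a
  simp only [len]
  omega

/-! ### Desubstitution of repetitions -/

/-- The factor of length `r + p` at position `i` has period `p`. -/
def Periodic (p i r : ℕ) : Prop := ∀ x < r, T (i + x) = T (i + x + p)

theorem Periodic.desubst {p i r : ℕ} (h : Periodic p i r) (hp : 0 < p) (hr : 0 < r) :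
    ∃ j s q, Periodic q j s ∧ 0 < q ∧ pos (j + q) = pos j + p ∧
      pos j ≤ i ∧ i ≤ pos j + 1 ∧ i + r ≤ pos (j + s) + 1 := by
  have h0 := h 0 hr
  rw [add_zero] at h0
  obtain ⟨j, hj1, hj2, k, hk⟩ : ∃ j, pos j ≤ i ∧ i ≤ pos j + 1 ∧ ∃ k, pos k = pos j + p := by
    obtain ⟨j, rfl | ⟨hc, rfl⟩⟩ := exists_pos i
    · rw [T_pos] at h0
      obtain ⟨k, hk⟩ := exists_pos_of_eq_a h0.symm
      exact ⟨j, le_rfl, by omega, k, hk.symm⟩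
    · rw [T_pos_add_one] at h0
      have hne : next (T j) ≠ a := fun h => hc (next_injective h)
      obtain ⟨k, -, hk⟩ := exists_pos_of_ne_a (i := pos j + 1 + p) (h0 ▸ hne)
      exact ⟨j, by omega, le_rfl, k, by omega⟩
  have hjk : j < k := pos_strictMono.lt_iff_lt.1 (by omega)
  obtain ⟨q, rfl⟩ := Nat.exists_eq_add_of_le hjk.le
  have hmatch : ∀ y, pos (j + y) + 1 < i + r → pos (j + y + q) = pos (j + y) + p →
      T (j + y) = T (j + y + q) := by
    intro y hy hq
    have hle : pos j ≤ pos (j + y) := pos_strictMono.monotone (by omega)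
    have h1 := h (pos (j + y) + 1 - i) (by omega)
    rw [Nat.add_sub_cancel' (by omega), add_right_comm, ← hq, T_pos_add_one, T_pos_add_one] at h1
    exact next_injective h1
  have hshift : ∀ y, (∀ z < y, pos (j + z) + 1 < i + r) → pos (j + y + q) = pos (j + y) + p := by
    intro y
    induction y with
    | zero => exact fun _ => hk
    | succ y ih =>
      intro hy
      have hq := ih fun z hz => hy z (by omega)
      have hT := hmatch y (hy y (by omega)) hq
      rw [← add_assoc, add_right_comm, pos_succ, pos_succ, hq, ← hT]
      omega
  have hex : ∃ s, i + r ≤ pos (j + s) + 1 :=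
    ⟨i + r, by have := pos_strictMono.le_apply (x := j + (i + r)); omega⟩
  classical
  have hlt : ∀ y < Nat.find hex, pos (j + y) + 1 < i + r := fun y hy =>
    not_le.1 (Nat.find_min hex hy)
  refine ⟨j, Nat.find hex, q, fun y hy => ?_, by omega, hk, hj1, hj2, Nat.find_spec hex⟩
  exact hmatch y (hlt y hy) (hshift y fun z hz => hlt z (hz.trans hy))

/-- A repetition of period `p` containing the square at position `i` is obtained
by applying `l` times the substitution to a repetition of period `q` at position `j`. -/
structure IsImage (p i l q j s : ℕ) : Prop where
  periodic : Periodic q j s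
  period_pos : 0 < q
  le : (pos^[l]) j ≤ i
  le_add : i + 2 * p ≤ (pos^[l]) (j + s) + bisp l
  shift : (pos^[l]) (j + q) = (pos^[l]) j + p

theorem IsImage.desubst {p i l q j s : ℕ} (h : IsImage p i l q j s) (hs : 0 < s) :
    ∃ q' j' s', IsImage p i (l + 1) q' j' s' ∧ pos (j' + q') = pos j' + q := by
  obtain ⟨j', s', q', h1, h2, h3, h4, h5, h6⟩ := h.periodic.desubst h.period_pos hs
  refine ⟨q', j', s', ⟨h1, h2, ?_, ?_, ?_⟩, h3⟩
  · exact ((iterate_pos_strictMono l).monotone h4).trans h.le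
  · have := (iterate_pos_strictMono l).monotone h6
    rw [iterate_pos_succ, T_pos] at this
    have h7 := h.le_add
    rw [Function.iterate_succ_apply]
    simp only [bisp]
    omega
  · rw [Function.iterate_succ_apply, Function.iterate_succ_apply, h3]
    have h7 := h.shift
    obtain rfl | rfl : j = pos j' ∨ j = pos j' + 1 := by omega
    · exact h7
    · have h8 := iterate_pos_succ l (pos j' + q)
      rw [add_right_comm, h8, iterate_pos_succ, ← h3, T_pos, T_pos] at h7
      rw [← h3]
      omega

theorem IsImage.of_eq_zero {p i l q j : ℕ} (h : IsImage p i l q j 0) :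
    T j = c ∧ 4 ≤ l ∧ (pos^[l]) j ≤ i ∧ i + 2 * p ≤ (pos^[l]) j + bisp l ∧ p = len l c := by
  obtain ⟨-, hq, h1, h2, h3⟩ := h
  rw [add_zero] at h2
  obtain ⟨hA, hB, -⟩ := bisp_lt l
  have hq1 : q = 1 := by
    by_contra hne
    have h4 := (iterate_pos_strictMono l).monotone (show j + 1 + 1 ≤ j + q by omega)
    rw [iterate_pos_succ, iterate_pos_succ] at h4
    have h5 : len l a ≤ len l (T j) + len l (T (j + 1)) := by
      by_cases ha : T j = a
      · rw [ha]; omega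
      · rw [T_succ_of_ne_a ha]; omega
    omega
  subst hq1
  rw [iterate_pos_succ] at h3
  cases hT : T j
  · rw [hT] at h3; omega
  · rw [hT] at h3; omega
  · rw [hT] at h3
    exact ⟨rfl, len_c_le_bisp.1 (by omega), h1, h2, by omega⟩

theorem eq_one_of_pos_add {j q : ℕ} (hq : 0 < q) (h : pos (j + q) ≤ pos j + q) :
    q = 1 ∧ T j = c := by
  have hc : T j = c := by
    by_contra hc
    have h1 := pos_strictMono.add_le_nat (q - 1) (j + 1)
    rw [pos_succ_of_ne hc, show q - 1 + (j + 1) = j + q by omega] at h1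
    omega
  refine ⟨?_, hc⟩
  by_contra hne
  have h1 := pos_strictMono.add_le_nat (q - 2) (j + 1 + 1)
  rw [pos_succ_of_ne (by simp [T_succ_of_ne_a (i := j), hc]), pos_succ_of_eq hc,
    show q - 2 + (j + 1 + 1) = j + q by omega] at h1
  omega

theorem IsImage.exists_eq_zero {p i : ℕ} (q : ℕ) :
    ∀ {l j s : ℕ}, IsImage p i l q j s → ∃ l' q' j', IsImage p i l' q' j' 0 := by
  induction q using Nat.strong_induction_on with
  | _ q ih =>
    intro l j s h
    rcases Nat.eq_zero_or_pos s with rfl | hs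
    · exact ⟨l, q, j, h⟩
    obtain ⟨q', j', s', h', hq⟩ := h.desubst hs
    by_cases hlt : q' < q
    · exact ih q' hlt h'
    · obtain ⟨rfl, hc⟩ := eq_one_of_pos_add h'.period_pos (j := j') (by omega)
      rcases Nat.eq_zero_or_pos s' with rfl | hs'
      · exact ⟨_, _, _, h'⟩
      · have h1 := h'.periodic 0 hs'
        rw [add_zero, hc, T_succ_of_ne_a (by simp [hc])] at h1
        exact absurd h1 (by simp)

/-- Cubes of the Tribonacci word have period `len l c` and start at
the image of an occurrence of the letter `c`. -/
theorem periodic_two_mul_iff {p i : ℕ} (hp : 0 < p) :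
    Periodic p i (2 * p) ↔ ∃ l j, T j = c ∧ 4 ≤ l ∧ pos^[l] j ≤ i ∧
      i + 2 * p ≤ pos^[l] j + bisp l ∧ p = len l c := by
  constructor
  · intro h
    have h0 : IsImage p i 0 p i (2 * p) := ⟨h, hp, le_rfl, le_rfl, rfl⟩
    obtain ⟨l, q, j, h1⟩ := h0.exists_eq_zero
    exact ⟨l, j, h1.of_eq_zero⟩
  · rintro ⟨l, j, hc, -, h1, h2, rfl⟩ x hx
    have h3 := prefixAt_bisp l j (i + x - pos^[l] j) (by omega)
    have h4 := prefixAt_bisp l (j + 1) (i + x - pos^[l] j) (by omega)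
    rw [iterate_pos_succ, hc] at h4
    rw [Nat.add_sub_cancel' (by omega)] at h3
    rw [show pos^[l] j + len l c + (i + x - pos^[l] j) = i + x + len l c by omega] at h4
    rw [h3, h4]

/-! ### Counting occurrences of cubes -/

/-- The factor of length `n` at position `i`. -/
def factor (i n : ℕ) : List TLetter := (List.range n).map fun x => T (i + x)

@[simp] theorem length_factor (i n : ℕ) : (factor i n).length = n := by simp [factor]

theorem factor_add (i m n : ℕ) : factor i (m + n) = factor i m ++ factor (i + m) n := by
  simp [factor, List.range_add, Function.comp_def, add_assoc]

theorem take_drop_pre {i m n : ℕ} (h : i + m ≤ n) : ((pre n).drop i).take m = factor i m := by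
  apply List.ext_getElem
  · simp; omega
  · intro x h1 h2
    simp [pre, factor]

theorem factor_eq_factor_iff {i j p : ℕ} :
    factor i p = factor j p ↔ ∀ x < p, T (i + x) = T (j + x) := by
  simp [factor]

theorem periodic_two_mul_iff_factor {p i : ℕ} :
    Periodic p i (2 * p) ↔ factor i p = factor (i + p) p ∧ factor i p = factor (i + p + p) p := by
  rw [factor_eq_factor_iff, factor_eq_factor_iff]
  constructor
  · intro h
    have h1 : ∀ x < p, T (i + x) = T (i + p + x) := fun x hx => by
      rw [h x (by omega), add_right_comm]
    refine ⟨h1, fun x hx => ?_⟩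
    rw [h1 x hx, add_assoc i p x, h (p + x) (by omega)]
    congr 1; omega
  · rintro ⟨h1, h2⟩ x hx
    rcases lt_or_ge x p with h | h
    · rw [h1 x h, add_right_comm]
    · obtain ⟨y, rfl⟩ := Nat.exists_eq_add_of_le h
      rw [← add_assoc, ← h1 y (by omega), h2 y (by omega)]
      congr 1; omega

theorem cube_prefix_iff {w : List TLetter} {i n : ℕ} (h : i + 3 * w.length ≤ n) :
    (w ++ w ++ w) <+: (TPrefix n).drop i ↔
      w = factor i w.length ∧ Periodic w.length i (2 * w.length) := by
  have hlen : (w ++ w ++ w).length = w.length + w.length + w.length := by simp [add_assoc]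
  rw [List.prefix_iff_eq_take, TPrefix_eq_pre, take_drop_pre (by rw [hlen]; omega), hlen,
    factor_add, factor_add, periodic_two_mul_iff_factor]
  generalize hp : w.length = p
  constructor
  · intro h
    obtain ⟨h12, h3⟩ := List.append_inj' h (by simp [hp])
    obtain ⟨h1, h2⟩ := List.append_inj' h12 (by simp [hp])
    refine ⟨h1, h1.symm.trans h2, h1.symm.trans ?_⟩
    rw [h3, ← add_assoc]
  · rintro ⟨h1, h2, h3⟩
    rw [← h2, ← add_assoc, ← h3, ← h1]

/-- The pairs of the period and the (zero-based) position of the cubes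
in the prefix of length `n`. -/
def cubeSet (n : ℕ) : Set (ℕ × ℕ) :=
  {p | 0 < p.1 ∧ p.2 + 3 * p.1 ≤ n ∧ Periodic p.1 p.2 (2 * p.1)}

theorem D_eq_ncard (n : ℕ) : D n = (cubeSet n).ncard := by
  rw [D, ← Nat.card_coe_set_eq]
  refine Nat.card_congr
    { toFun := fun q => ⟨(q.1.1.length, q.1.2 - 1), ?_⟩
      invFun := fun q => ⟨(factor q.1.2 q.1.1, q.1.2 + 1), ?_⟩
      left_inv := ?_
      right_inv := ?_ }
  · obtain ⟨⟨w, i⟩, hw, hi, hle, h⟩ := q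
    have hpos := List.length_pos_iff.2 hw
    have hle' : i - 1 + 3 * w.length ≤ n := by dsimp only at hi hle; omega
    exact ⟨hpos, hle', ((cube_prefix_iff hle').1 h).2⟩
  · obtain ⟨⟨p, i⟩, hp, hle, h⟩ := q
    dsimp only at *
    have hlen := length_factor i p
    refine ⟨fun h => ?_, by omega, by omega, ?_⟩
    · rw [h] at hlen
      simp at hlen
      omega
    · rw [Nat.add_sub_cancel, cube_prefix_iff (by omega)]
      simpa using h
  · rintro ⟨⟨w, i⟩, hw, hi, hle, h⟩
    have hpos := List.length_pos_iff.2 hw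
    dsimp only at *
    have h1 := ((cube_prefix_iff (by omega)).1 h).1
    simp [← h1, hi]
  · rintro ⟨⟨p, i⟩, hp, hle, h⟩
    simp

theorem cubeSet_finite (n : ℕ) : (cubeSet n).Finite := by
  refine ((Finset.range (n + 1)) ×ˢ (Finset.range (n + 1))).finite_toSet.subset ?_
  rintro ⟨p, i⟩ ⟨h1, h2, -⟩
  simp only [Finset.coe_product, Finset.coe_range, Set.mem_prod, Set.mem_Iio]
  dsimp only at h1 h2
  omega

theorem D_eq_add_ncard {n N : ℕ} (h : n ≤ N) :
    D N = D n + (cubeSet N \ cubeSet n).ncard := by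
  have hsub : cubeSet n ⊆ cubeSet N := fun p hp => ⟨hp.1, hp.2.1.trans h, hp.2.2⟩
  rw [D_eq_ncard, D_eq_ncard, add_comm, Set.ncard_sdiff_add_ncard_of_subset hsub (cubeSet_finite N)]

theorem len_a_strictMono : StrictMono fun l => len l a := by
  refine strictMono_nat_of_lt_succ fun l => ?_
  have := len_pos l b
  simp only [len]
  omega

theorem bisp_lt_three_mul {l : ℕ} (hl : 1 ≤ l) : bisp l < 3 * len l c := by
  obtain ⟨k, rfl⟩ := Nat.exists_eq_add_of_le' hl
  have := (bisp_lt k).1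
  simp only [bisp, len]
  omega

theorem T_one : T 1 = b := T_pos_add_one 0 |>.trans (by rw [T_zero]; rfl)

/-- The cubes ending in the window `(bisp (n + 5), len (n + 6) a]`. -/
theorem mem_window_iff {n l j x : ℕ} (hl : 4 ≤ l) (hj : T j = c) (hx : x + 2 * len l c ≤ bisp l) :
    (bisp (n + 5) < pos^[l] j + x + 3 * len l c ∧
        pos^[l] j + x + 3 * len l c ≤ len (n + 6) a) ↔
      ∃ z, l + z = n + 3 ∧ bisp (z + 2) ≤ j ∧ j + 3 ≤ len (z + 3) a := by
  have hmono := (iterate_pos_strictMono l).monotone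
  obtain ⟨hA, hB, -⟩ := bisp_lt l
  have hC := bisp_lt_three_mul (l := l) (by omega)
  have hAC := len_a_lt_two_mul (l := l) (by omega)
  have e1 : pos^[l] (j + 1) = pos^[l] j + len l c := by rw [iterate_pos_succ, hj]
  have e2 : pos^[l] (j + 2) = pos^[l] j + len l c + len l a := by
    rw [iterate_pos_succ l (j + 1), e1, T_succ_of_ne_a (by simp [hj])]
  have e3 : pos^[l] (j + 3) = pos^[l] j + len l c + len l a + len l b := by
    rw [iterate_pos_succ l (j + 2), e2, T_add_two_of_eq_c hj]
  have hj0 : j ≠ 0 := by rintro rfl; simp [T_zero] at hj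
  have hj1 : j ≠ 1 := by rintro rfl; simp [T_one] at hj
  rcases le_or_gt l (n + 5) with hln | hln
  · obtain ⟨y, hy⟩ := Nat.exists_eq_add_of_le hln
    have w1 : pos^[l] (bisp y) + bisp l = bisp (n + 5) := by
      rw [iterate_pos_bisp, hy, add_comm]
    have w2 : pos^[l] (len (y + 1) a) = len (n + 6) a := by
      rw [iterate_pos_len, ← add_assoc, ← hy]
    have k1 : bisp (n + 5) < pos^[l] j + x + 3 * len l c ↔ bisp y ≤ j := by
      constructor
      · intro h
        by_contra! hlt
        have := hmono (show j + 1 ≤ bisp y from hlt)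
        omega
      · intro h
        have := hmono h
        omega
    have k2 : pos^[l] j + x + 3 * len l c ≤ len (n + 6) a ↔ j + 3 ≤ len (y + 1) a := by
      constructor
      · intro h
        by_contra! hlt
        have := hmono (show len (y + 1) a ≤ j + 2 by omega)
        omega
      · intro h
        have := hmono h
        omega
    rw [k1, k2]
    constructor
    · rintro ⟨h1, h2⟩
      have hy2 : 2 ≤ y := by
        by_contra! hlt
        interval_cases y
        · simp [len] at h2
        · simp [len] at h2; omega
      obtain ⟨z, rfl⟩ := Nat.exists_eq_add_of_le' hy2
      exact ⟨z, by omega, h1, h2⟩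
    · rintro ⟨z, hz, h1, h2⟩
      obtain rfl : y = z + 2 := by omega
      exact ⟨h1, h2⟩
  · have h1 := hmono (show 1 ≤ j by omega)
    have h2 := len_a_strictMono.monotone (show n + 6 ≤ l by omega)
    have h3 := len_pos l c
    rw [iterate_pos_one] at h1
    constructor
    · intro h; omega
    · rintro ⟨z, hz, -⟩; omega

theorem eq_of_iterate_pos_add_eq {l j x j' x' : ℕ} (hl : 1 ≤ l) (hj : T j = c)
    (hx : x + 2 * len l c ≤ bisp l) (h : pos^[l] j + x = pos^[l] j' + x') : j' ≤ j := by
  by_contra! hlt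
  have h1 := (iterate_pos_strictMono l).monotone (show j + 1 ≤ j' from hlt)
  have h2 := bisp_lt_three_mul hl
  rw [iterate_pos_succ, hj] at h1
  omega

/-- The positions of the letter `c` in the window `[bisp (z + 2), len (z + 3) a - 2)`. -/
def windowC (z : ℕ) : Finset ℕ :=
  (Finset.Ico (bisp (z + 2)) (len (z + 3) a - 2)).filter fun j => T j = c

theorem ncard_window (n : ℕ) :
    (cubeSet (len (n + 6) a) \ cubeSet (bisp (n + 5))).ncard =
      ∑ z ∈ Finset.range n,
        (windowC z).card * (bisp (n + 2 - z + 1) + 1 - 2 * len (n + 2 - z) a) := by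
  let s : Finset (Σ _ : ℕ, ℕ × ℕ) := (Finset.range n).sigma fun z =>
    windowC z ×ˢ Finset.range (bisp (n + 2 - z + 1) + 1 - 2 * len (n + 2 - z) a)
  let f : (Σ _ : ℕ, ℕ × ℕ) → ℕ × ℕ := fun q =>
    (len (n + 2 - q.1 + 1) c, pos^[n + 2 - q.1 + 1] q.2.1 + q.2.2)
  have hs : ∀ q ∈ s, q.1 < n ∧ bisp (q.1 + 2) ≤ q.2.1 ∧ q.2.1 + 3 ≤ len (q.1 + 3) a ∧
      T q.2.1 = c ∧ q.2.2 + 2 * len (n + 2 - q.1 + 1) c ≤ bisp (n + 2 - q.1 + 1) := by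
    rintro ⟨z, j, x⟩ h
    simp only [s, windowC, Finset.mem_sigma, Finset.mem_product, Finset.mem_filter,
      Finset.mem_Ico, Finset.mem_range] at h
    obtain ⟨h1, ⟨⟨h2, h3⟩, h4⟩, h5⟩ := h
    refine ⟨h1, h2, show j + 3 ≤ len (z + 3) a by omega, h4, ?_⟩
    simp only [len]
    omega
  have himage : cubeSet (len (n + 6) a) \ cubeSet (bisp (n + 5)) = f '' s := by
    ext ⟨p, i⟩
    constructor
    · rintro ⟨⟨h1, h2, h3⟩, h4⟩
      have h5 : bisp (n + 5) < i + 3 * p := by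
        by_contra! hle
        exact h4 ⟨h1, hle, h3⟩
      dsimp only at h1 h2 h3
      obtain ⟨l, j, hj, hl, hi, hip, rfl⟩ := (periodic_two_mul_iff h1).1 h3
      obtain ⟨x, rfl⟩ := Nat.exists_eq_add_of_le hi
      obtain ⟨z, hz, hz1, hz2⟩ := (mem_window_iff hl hj (by omega)).1 ⟨h5, h2⟩
      obtain rfl : l = n + 2 - z + 1 := by omega
      refine ⟨⟨z, j, x⟩, ?_, rfl⟩
      simp only [len] at hip
      simp only [s, windowC, Finset.coe_sigma, Set.mem_sigma_iff, Finset.mem_coe,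
        Finset.mem_product, Finset.mem_filter, Finset.mem_Ico, Finset.mem_range]
      exact ⟨by omega, ⟨⟨hz1, by omega⟩, hj⟩, by omega⟩
    · rintro ⟨⟨z, j, x⟩, hq, hf⟩
      obtain ⟨h1, h2, h3, h4, h5⟩ := hs _ hq
      dsimp only at h1 h2 h3 h4 h5
      simp only [f, Prod.mk.injEq] at hf
      obtain ⟨rfl, rfl⟩ := hf
      have hl : 4 ≤ n + 2 - z + 1 := by omega
      obtain ⟨h6, h7⟩ := (mem_window_iff (n := n) hl h4 h5).2 ⟨z, by omega, h2, h3⟩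
      have hp := len_pos (n + 2 - z + 1) c
      refine ⟨⟨hp, h7, (periodic_two_mul_iff hp).2
        ⟨_, j, h4, hl, by omega, by omega, rfl⟩⟩, fun h => ?_⟩
      have := h.2.1
      dsimp only at this
      omega
  have hinj : Set.InjOn f s := by
    rintro ⟨z, j, x⟩ hq ⟨z', j', x'⟩ hq' hf
    obtain ⟨h1, -, -, h4, h5⟩ := hs _ hq
    obtain ⟨h1', -, -, h4', h5'⟩ := hs _ hq'
    dsimp only at h1 h4 h5 h1' h4' h5'
    simp only [f, Prod.mk.injEq] at hf
    obtain ⟨hf1, hf2⟩ := hf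
    have hz : n + 2 - z = n + 2 - z' := len_a_strictMono.injective hf1
    obtain rfl : z = z' := by omega
    obtain rfl : j = j' := le_antisymm (eq_of_iterate_pos_add_eq (by omega) h4' h5' hf2.symm)
      (eq_of_iterate_pos_add_eq (by omega) h4 h5 hf2)
    obtain rfl : x = x' := by omega
    rfl
  rw [himage, hinj.ncard_image, Set.ncard_coe_finset, Finset.card_sigma]
  simp only [Finset.card_product, Finset.card_range]

/-! ### Counting letters -/

/-- The number of occurrences of a letter in the prefix of length `n`. -/
def letterCount (x : TLetter) (n : ℕ) : ℕ := Nat.count (fun j => T j = x) n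

theorem letterCount_succ (x : TLetter) (n : ℕ) :
    letterCount x (n + 1) = letterCount x n + if T n = x then 1 else 0 := Nat.count_succ _ _

theorem letterCount_pos (n : ℕ) :
    letterCount a (pos n) = n ∧ letterCount b (pos n) = letterCount a n ∧
      letterCount c (pos n) = letterCount b n := by
  induction n with
  | zero => exact ⟨rfl, rfl, rfl⟩
  | succ n ih =>
    obtain ⟨h1, h2, h3⟩ := ih
    cases hT : T n
    · rw [pos_succ_of_ne (by simp [hT])]
      simp [letterCount_succ, T_pos, T_pos_add_one, hT, next, h1, h2, h3]
    · rw [pos_succ_of_ne (by simp [hT])]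
      simp [letterCount_succ, T_pos, T_pos_add_one, hT, next, h1, h2, h3]
    · rw [pos_succ_of_eq hT]
      simp [letterCount_succ, T_pos, hT, h1, h2, h3]

theorem letterCount_c_pos (n : ℕ) : letterCount c (pos (pos (pos n))) = n := by
  rw [(letterCount_pos _).2.2, (letterCount_pos _).2.1, (letterCount_pos _).1]

theorem pos_len (k : ℕ) : pos (len k a) = len (k + 1) a := by
  rw [add_comm, ← iterate_pos_len 1, Function.iterate_one]

theorem letterCount_c_len (k : ℕ) : letterCount c (len (k + 3) a) = len k a := by
  rw [← pos_len (k + 2), ← pos_len (k + 1), ← pos_len k, letterCount_c_pos]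

theorem letterCount_c_bisp (k : ℕ) : letterCount c (bisp (k + 3)) = bisp k + 1 := by
  rw [← pos_bisp (k + 2), letterCount_succ, (letterCount_pos _).2.2, ← pos_bisp (k + 1),
    letterCount_succ, (letterCount_pos _).2.1, ← pos_bisp k, letterCount_succ,
    (letterCount_pos _).1]
  simp [T_pos]

theorem T_pos_succ_sub_one (j : ℕ) : T (pos (j + 1) - 1) = next (T j) := by
  by_cases hc : T j = c
  · rw [pos_succ_of_eq hc, Nat.add_sub_cancel, T_pos, hc]; rfl
  · rw [pos_succ_of_ne hc, ← T_pos_add_one]; rfl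

theorem T_len_sub_one (k : ℕ) : T (len k a - 1) = next^[k] a := by
  induction k with
  | zero => exact T_zero
  | succ k ih =>
    have h := T_pos_succ_sub_one (len k a - 1)
    rw [Nat.sub_add_cancel (len_pos k a), pos_len, ih] at h
    rw [h, Function.iterate_succ_apply']

theorem iterate_next_eq_c_iff (k : ℕ) : next^[k] a = c ↔ k % 3 = 2 := by
  induction k using Nat.strong_induction_on with
  | _ k ih =>
    rcases lt_or_ge k 3 with h | h
    · interval_cases k <;> simp [next]
    · obtain ⟨n, rfl⟩ := Nat.exists_eq_add_of_le' h
      rw [Nat.add_mod_right, ← ih n (by omega), Function.iterate_add_apply]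
      rfl

theorem T_len_sub_two_ne {k : ℕ} (hk : 1 ≤ k) : T (len k a - 2) ≠ c := by
  intro h
  have h1 := T_add_two_of_eq_c h
  obtain ⟨n, rfl⟩ := Nat.exists_eq_add_of_le' hk
  have h2 := len_pos n a
  have h3 := len_pos n b
  rw [Nat.sub_add_cancel (by simp only [len]; omega), ← pos_len, T_pos] at h1
  simp at h1

theorem card_windowC_add (z : ℕ) :
    (windowC z).card + letterCount c (bisp (z + 2)) = letterCount c (len (z + 3) a - 2) := by
  have hle : bisp (z + 2) ≤ len (z + 3) a - 2 := by
    have h1 : 2 * bisp (z + 2) + 3 = len (z + 3) a + len (z + 1) a := two_mul_bisp (z + 1)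
    have h2 := len_add_three z
    have h3 := len_pos z a
    have h4 := len_a_strictMono.monotone (show z + 1 ≤ z + 2 by omega)
    have h5 := len_a_strictMono.monotone (show 1 ≤ z + 2 by omega)
    have h6 : len 1 a = 2 := rfl
    omega
  rw [letterCount, letterCount, Nat.count_eq_card_filter_range, Nat.count_eq_card_filter_range,
    windowC, ← Finset.card_union_of_disjoint, ← Finset.filter_union]
  · congr 2
    ext x
    simp only [Finset.mem_union, Finset.mem_Ico, Finset.mem_range]
    omega
  · refine Finset.disjoint_filter_filter (Finset.disjoint_left.2 fun x h1 h2 => ?_)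
    simp only [Finset.mem_Ico, Finset.mem_range] at h1 h2
    omega

theorem two_mul_letterCount_c_bisp (z : ℕ) :
    2 * letterCount c (bisp (z + 2)) + 1 = len z a + tribAux z := by
  rcases z with _ | _ | _ | z
  · have h : letterCount c (bisp 2) + 0 = 0 := by
      rw [← pos_bisp 1, letterCount_succ, (letterCount_pos _).2.2, T_pos]
      rw [show bisp 1 = 0 + 1 from rfl, letterCount_succ, T_zero]
      simp [letterCount]
    simp only [zero_add]
    simp at h
    rw [h]; rfl
  · rw [letterCount_c_bisp]; rfl
  · rw [letterCount_c_bisp]; rfl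
  · have h1 := two_mul_bisp (z + 1)
    have h2 := (len_eq_tribAux (z + 1)).1
    rw [letterCount_c_bisp]
    rw [show z + 1 + 1 + 1 = z + 1 + 2 by omega] at *
    rw [← h2]
    omega

theorem two_mul_card_windowC (z : ℕ) :
    2 * (windowC z).card + tribAux z + (if z % 3 = 2 then 2 else 0) = tribAux (z + 2) + 1 := by
  have h1 := card_windowC_add z
  have h2 := two_mul_letterCount_c_bisp z
  have h3 := letterCount_c_len z
  have h4 := (len_eq_tribAux z).1
  have h5 := T_len_sub_one (z + 3)
  have h6 := T_len_sub_two_ne (k := z + 3) (by omega)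
  have h7 : 2 ≤ len (z + 3) a := len_a_strictMono.monotone (show 1 ≤ z + 3 by omega)
  obtain ⟨L, hL⟩ := Nat.exists_eq_add_of_le' h7
  rw [hL] at h1 h3 h5 h6
  rw [Nat.add_sub_cancel] at h1 h6
  rw [show L + 2 - 1 = L + 1 by omega] at h5
  rw [letterCount_succ, letterCount_succ, if_neg h6, h5] at h3
  simp only [iterate_next_eq_c_iff, Nat.add_mod_right] at h3
  split_ifs at h3 ⊢ <;> omega

/-! ### Evaluation of the sum -/

/-- The number of cubes of period `len k a` in a maximal repetition of that period. -/
def cubeCount (k : ℕ) : ℚ := bisp (k + 1) + 1 - 2 * len k a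

theorem two_mul_len_le_bisp (k : ℕ) : 2 * len k a ≤ bisp (k + 1) + 1 := by
  rcases lt_or_ge k 3 with h | h
  · interval_cases k <;> decide
  · have := len_c_le_bisp.2 (show 4 ≤ k + 1 by omega)
    simp only [len] at this
    omega

theorem two_mul_cubeCount (k : ℕ) :
    2 * cubeCount k = tribAux (k + 4) - 3 * tribAux (k + 2) - 1 := by
  have h : (2 * bisp (k + 1) + 3 : ℚ) = len (k + 2) a + len k a := by
    exact_mod_cast two_mul_bisp k
  obtain ⟨h0, -, h2⟩ := len_eq_tribAux k
  rw [h0, h2] at h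
  rw [cubeCount, h0]
  linarith

theorem tribAux_add_three (k : ℕ) :
    (tribAux (k + 3) : ℚ) = tribAux (k + 2) + tribAux (k + 1) + tribAux k := by
  exact_mod_cast (rfl : tribAux (k + 3) = _)

theorem cubeCount_add_three (k : ℕ) :
    cubeCount (k + 3) = cubeCount (k + 2) + cubeCount (k + 1) + cubeCount k + 1 := by
  have h := two_mul_cubeCount
  have h0 := h k
  have h1 := h (k + 1)
  have h2 := h (k + 2)
  have h3 := h (k + 3)
  have e2 := tribAux_add_three (k + 2)
  have e4 := tribAux_add_three (k + 4)
  simp only [add_assoc, Nat.reduceAdd] at *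
  linarith

/-- The number of cubes in the window `(bisp (n + 5), len (n + 6) a]`. -/
def windowSum (n : ℕ) : ℚ :=
  ∑ z ∈ Finset.range n, ((windowC z).card : ℚ) * cubeCount (n + 2 - z)

theorem windowSum_add_three (n : ℕ) :
    windowSum (n + 3) = windowSum (n + 2) + windowSum (n + 1) + windowSum n +
      ∑ z ∈ Finset.range (n + 3), ((windowC z).card : ℚ) := by
  have c0 : cubeCount 0 = 0 := by norm_num [cubeCount, bisp, len]
  have c1 : cubeCount 1 = 0 := by norm_num [cubeCount, bisp, len]
  have c2 : cubeCount 2 = 0 := by norm_num [cubeCount, bisp, len]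
  have e2 : windowSum (n + 2) =
      ∑ z ∈ Finset.range (n + 3), ((windowC z).card : ℚ) * cubeCount (n + 2 - z + 2) := by
    rw [windowSum, Finset.sum_range_succ _ (n + 2), Nat.sub_self, zero_add, c2, mul_zero, add_zero]
    refine Finset.sum_congr rfl fun z hz => ?_
    rw [Finset.mem_range] at hz
    rw [show n + 2 + 2 - z = n + 2 - z + 2 by omega]
  have e1 : windowSum (n + 1) =
      ∑ z ∈ Finset.range (n + 3), ((windowC z).card : ℚ) * cubeCount (n + 2 - z + 1) := by
    rw [windowSum, Finset.sum_range_succ _ (n + 2), Finset.sum_range_succ _ (n + 1),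
      show n + 2 - (n + 1) + 1 = 2 by omega, show n + 2 - (n + 2) + 1 = 1 by omega, c2, c1]
    simp only [mul_zero, add_zero]
    refine Finset.sum_congr rfl fun z hz => ?_
    rw [Finset.mem_range] at hz
    rw [show n + 1 + 2 - z = n + 2 - z + 1 by omega]
  have e0 : windowSum n =
      ∑ z ∈ Finset.range (n + 3), ((windowC z).card : ℚ) * cubeCount (n + 2 - z) := by
    rw [windowSum, Finset.sum_range_succ _ (n + 2), Finset.sum_range_succ _ (n + 1),
      Finset.sum_range_succ _ n, show n + 2 - n = 2 by omega,
      show n + 2 - (n + 1) = 1 by omega, show n + 2 - (n + 2) = 0 by omega, c2, c1, c0]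
    simp only [mul_zero, add_zero]
  rw [e2, e1, e0, windowSum, ← Finset.sum_add_distrib, ← Finset.sum_add_distrib,
    ← Finset.sum_add_distrib]
  refine Finset.sum_congr rfl fun z hz => ?_
  rw [Finset.mem_range] at hz
  rw [show n + 3 + 2 - z = n + 2 - z + 3 by omega, cubeCount_add_three]
  ring

theorem two_mul_sum_card_windowC (n : ℕ) :
    2 * ∑ z ∈ Finset.range n, (windowC z).card + 1 + 2 * (n / 3) =
      tribAux (n + 1) + tribAux n + n := by
  induction n with
  | zero => rfl
  | succ n ih =>
    have h := two_mul_card_windowC n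
    rw [Finset.sum_range_succ]
    change _ = tribAux (n + 2) + tribAux (n + 1) + (n + 1)
    split_ifs at h <;> omega

theorem windowSum_eq (n : ℕ) :
    windowSum n = ((n : ℚ) + 6) / 44 *
        (-7 * (tribAux (n + 8) : ℚ) + 2 * tribAux (n + 7) + 21 * tribAux (n + 6)) +
      1 / 11 * (-10 * (tribAux (n + 8) : ℚ) + 21 * tribAux (n + 7) - 6 * tribAux (n + 6)) -
      ((n : ℚ) + 6) / 12 + ((n % 3 : ℕ) : ℚ) / 3 := by
  induction n using Nat.strong_induction_on with
  | _ n ih =>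
    rcases lt_or_ge n 3 with h | h
    · have w0 : (windowC 0).card = 1 := by
        have := two_mul_card_windowC 0
        simp [tribAux] at this; omega
      have w1 : (windowC 1).card = 1 := by
        have := two_mul_card_windowC 1
        simp [tribAux] at this; omega
      interval_cases n <;>
        norm_num [windowSum, Finset.sum_range_succ, w0, w1, tribAux, cubeCount, bisp, len]
    · obtain ⟨k, rfl⟩ := Nat.exists_eq_add_of_le' h
      have hsum : (2 * ∑ z ∈ Finset.range (k + 3), ((windowC z).card : ℚ) + 1 +
          2 * ((k + 3) / 3 : ℕ) : ℚ) = tribAux (k + 4) + tribAux (k + 3) + (k + 3) := by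
        exact_mod_cast two_mul_sum_card_windowC (k + 3)
      have hdiv : (3 * ((k + 3) / 3 : ℕ) + ((k + 3) % 3 : ℕ) : ℚ) = k + 3 := by
        exact_mod_cast Nat.div_add_mod (k + 3) 3
      have hmod : (((k + 2) % 3 : ℕ) + ((k + 1) % 3 : ℕ) + (k % 3 : ℕ) : ℚ) = 3 := by
        exact_mod_cast (by omega : (k + 2) % 3 + (k + 1) % 3 + k % 3 = 3)
      rw [windowSum_add_three, ih (k + 2) (by omega), ih (k + 1) (by omega), ih k (by omega)]
      have e := fun j => tribAux_add_three (k + j)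
      have e3 := e 3
      have e4 := e 4
      have e5 := e 5
      have e6 := e 6
      have e7 := e 7
      have e8 := e 8
      simp only [add_assoc, Nat.reduceAdd] at *
      push_cast
      rw [Nat.add_mod_right] at hdiv ⊢
      rw [e8, e7, e6, e5, e4, e3]
      linear_combination hsum / 2 - hdiv / 3 + hmod / 3

end TribonacciCubes

theorem repeated_cubes_tail_sum (m : ℤ) (hm : 7 ≤ m) :
    (D (t m) : ℚ) - (D ((t m + t (m - 2) - 3) / 2) : ℚ) =
      (m : ℚ) / 44 * (-7 * (t m : ℚ) + 2 * (t (m - 1) : ℚ) + 21 * (t (m - 2) : ℚ)) +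
      1 / 11 * (-10 * (t m : ℚ) + 21 * (t (m - 1) : ℚ) - 6 * (t (m - 2) : ℚ)) -
      (m : ℚ) / 12 +
      1 / 3 * (if m % 3 = 1 then 1 else 0) +
      2 / 3 * (if m % 3 = 2 then 1 else 0) := by
  open TribonacciCubes in
  obtain ⟨n, rfl⟩ : ∃ n : ℕ, m = n + 6 := ⟨(m - 6).toNat, by omega⟩
  have t0 : t ((n : ℤ) + 6) = tribAux (n + 8) := by
    rw [t]; congr 1
  have t1 : t ((n : ℤ) + 6 - 1) = tribAux (n + 7) := by
    rw [t]; congr 1; omega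
  have t2 : t ((n : ℤ) + 6 - 2) = tribAux (n + 6) := by
    rw [t]; congr 1; omega
  obtain ⟨l0, -, l2⟩ := len_eq_tribAux (n + 4)
  have l0' : len (n + 4) .a = tribAux (n + 6) := l0
  have l2' : len (n + 6) .a = tribAux (n + 8) := l2
  have hb : 2 * bisp (n + 5) + 3 = len (n + 6) .a + len (n + 4) .a := two_mul_bisp (n + 4)
  have hle : bisp (n + 5) ≤ len (n + 6) .a := by
    have := len_a_strictMono.monotone (show n + 4 ≤ n + 6 by omega)
    omega
  have hwin : ((cubeSet (len (n + 6) .a) \ cubeSet (bisp (n + 5))).ncard : ℚ) = windowSum n := by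
    rw [ncard_window, windowSum, Nat.cast_sum]
    refine Finset.sum_congr rfl fun z _ => ?_
    rw [Nat.cast_mul, Nat.cast_sub (two_mul_len_le_bisp _), cubeCount]
    push_cast
    rfl
  have hmod : (((n % 3 : ℕ) : ℚ) / 3) = 1 / 3 * (if ((n : ℤ) + 6) % 3 = 1 then 1 else 0) +
      2 / 3 * (if ((n : ℤ) + 6) % 3 = 2 then 1 else 0) := by
    have h3 : n % 3 = 0 ∨ n % 3 = 1 ∨ n % 3 = 2 := by omega
    rcases h3 with h | h | h
    · rw [h, if_neg (by omega), if_neg (by omega)]; norm_num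
    · rw [h, if_pos (by omega), if_neg (by omega)]; norm_num
    · rw [h, if_neg (by omega), if_pos (by omega)]; norm_num
  rw [t0, t1, t2, ← l2', ← l0', show (len (n + 6) .a + len (n + 4) .a - 3) / 2 = bisp (n + 5) by
    omega, D_eq_add_ncard hle, Nat.cast_add, add_sub_cancel_left, hwin, windowSum_eq, hmod,
    l2', l0']
  push_cast
  ring
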